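/- The category of sl₂-crystals cannot be given the structure of a braided monoidal category: there is no braiding σ on this category. Specifically, any candidate commutor σ must satisfy σ_{B₁,B₁} = id (since B₁ ⊗ B₁ ≅ B₂ ⊕ B₀ is multiplicity-free), and naturality with respect to the inclusion B₂ ↪ B₁ ⊗ B₁ forces σ_{B₁, B₁⊗B₁}(b₁ ⊗ b₋₁ ⊗ b₁) = b₁ ⊗ b₁ ⊗ b₋₁, contradicting the hexagon identity which would give σ_{B₁, B₁⊗B₁} = (id ⊗ σ_{B₁,B₁})(σ_{B₁,B₁} ⊗ id) = id. -/

import Mathlib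

/-- An `sl₂`-crystal datum: a set with crystal operators `ẽ`, `f̃`, a weight function,
and the string functions `ε`, `φ`. -/
structure Sl2Crystal where
  carrier : Type
  e : carrier → Option carrier
  f : carrier → Option carrier
  wt : carrier → ℤ
  eps : carrier → ℕ
  phi : carrier → ℕ

/-- The crystal `B_n` of the irreducible highest weight `U_q(sl₂)`-module of highest
weight `n`: elements `b_n, b_{n-2}, …, b_{-n}` (the `i`-th element is `b_{n-2i}`),
with `f̃ b_j = b_{j-2}`, `ẽ b_j = b_{j+2}`. -/
def Bc (n : ℕ) : Sl2Crystal where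
  carrier := Fin (n + 1)
  e i := if _ : 0 < (i : ℕ) then some ⟨(i : ℕ) - 1, by omega⟩ else none
  f i := if _ : (i : ℕ) < n then some ⟨(i : ℕ) + 1, by omega⟩ else none
  wt i := (n : ℤ) - 2 * (i : ℕ)
  eps i := i
  phi i := n - i

/-- The Kashiwara tensor product of two `sl₂`-crystals:
`f̃(b ⊗ b') = f̃b ⊗ b'` if `φ(b) > ε(b')`, else `b ⊗ f̃b'`;
`ẽ(b ⊗ b') = ẽb ⊗ b'` if `φ(b) ≥ ε(b')`, else `b ⊗ ẽb'`. -/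
def tensorC (A B : Sl2Crystal) : Sl2Crystal where
  carrier := A.carrier × B.carrier
  e x := if B.eps x.2 ≤ A.phi x.1 then (A.e x.1).map (fun a => (a, x.2))
         else (B.e x.2).map (fun b => (x.1, b))
  f x := if B.eps x.2 < A.phi x.1 then (A.f x.1).map (fun a => (a, x.2))
         else (B.f x.2).map (fun b => (x.1, b))
  wt x := A.wt x.1 + B.wt x.2
  eps x := (max (A.eps x.1 : ℤ) ((B.eps x.2 : ℤ) - A.wt x.1)).toNat
  phi x := (max (B.phi x.2 : ℤ) ((A.phi x.1 : ℤ) + B.wt x.2)).toNat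

/-- The direct sum of two `sl₂`-crystals. -/
def csum (A B : Sl2Crystal) : Sl2Crystal where
  carrier := A.carrier ⊕ B.carrier
  e x := x.elim (fun a => ((A.e a).map Sum.inl)) (fun b => ((B.e b).map Sum.inr))
  f x := x.elim (fun a => ((A.f a).map Sum.inl)) (fun b => ((B.f b).map Sum.inr))
  wt x := x.elim A.wt B.wt
  eps x := x.elim A.eps B.eps
  phi x := x.elim A.phi B.phi

/-- A (strict) morphism of `sl₂`-crystals: commutes with `ẽ` and `f̃` and preserves
`wt`, `ε` and `φ`. -/
structure CrystalHom (A B : Sl2Crystal) where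
  toFun : A.carrier → B.carrier
  map_e : ∀ x, (A.e x).map toFun = B.e (toFun x)
  map_f : ∀ x, (A.f x).map toFun = B.f (toFun x)
  map_wt : ∀ x, B.wt (toFun x) = A.wt x
  map_eps : ∀ x, B.eps (toFun x) = A.eps x
  map_phi : ∀ x, B.phi (toFun x) = A.phi x

/-- An isomorphism of `sl₂`-crystals. -/
structure CrystalIso (A B : Sl2Crystal) where
  toEquiv : A.carrier ≃ B.carrier
  map_e : ∀ x, (A.e x).map toEquiv = B.e (toEquiv x)
  map_f : ∀ x, (A.f x).map toEquiv = B.f (toEquiv x)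
  map_wt : ∀ x, B.wt (toEquiv x) = A.wt x
  map_eps : ∀ x, B.eps (toEquiv x) = A.eps x
  map_phi : ∀ x, B.phi (toEquiv x) = A.phi x

/-- The disjoint union of highest weight `sl₂`-crystals `B_{m i}`, `i : ι`. -/
def sigmaCrystal (ι : Type) (m : ι → ℕ) : Sl2Crystal where
  carrier := Σ i : ι, Fin (m i + 1)
  e x := ((Bc (m x.1)).e x.2).map (fun y => ⟨x.1, y⟩)
  f x := ((Bc (m x.1)).f x.2).map (fun y => ⟨x.1, y⟩)
  wt x := (Bc (m x.1)).wt x.2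
  eps x := (Bc (m x.1)).eps x.2
  phi x := (Bc (m x.1)).phi x.2

/-- An `sl₂`-crystal is *normal* (an object of the category of `sl₂`-crystals) if each
of its connected components is isomorphic to some `B_n`, i.e. if it is isomorphic to a
disjoint union of crystals `B_{m i}`. -/
def IsNormal (A : Sl2Crystal) : Prop :=
  ∃ (ι : Type) (m : ι → ℕ), Nonempty (CrystalIso A (sigmaCrystal ι m))

theorem isNormal_Bc (n : ℕ) : IsNormal (Bc n) := by
  refine ⟨Unit, fun _ => n, ⟨⟨⟨fun x => ⟨(), x⟩, fun y => y.2, fun _ => rfl, fun _ => rfl⟩,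
    fun _ => rfl, fun _ => rfl, fun _ => rfl, fun _ => rfl, fun _ => rfl⟩⟩⟩

/-- The multiplicities of the decomposition of `B₁ ⊗ B₁`. -/
def m11 : Bool → ℕ
  | true => 2
  | false => 0

/-- The map `B₁ ⊗ B₁ → B₂ ⊕ B₀`. -/
def to11 : Fin 2 × Fin 2 → Σ i : Bool, Fin (m11 i + 1)
  | (0, 0) => ⟨true, (0 : Fin 3)⟩
  | (1, 0) => ⟨true, (1 : Fin 3)⟩
  | (1, 1) => ⟨true, (2 : Fin 3)⟩
  | (0, 1) => ⟨false, (0 : Fin 1)⟩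

/-- The inclusion of `B₂` in `B₁ ⊗ B₁`. -/
def incl2 : Fin 3 → Fin 2 × Fin 2
  | 0 => (0, 0)
  | 1 => (1, 0)
  | 2 => (1, 1)

/-- The inverse map `B₂ ⊕ B₀ → B₁ ⊗ B₁`. -/
def of11 : (Σ i : Bool, Fin (m11 i + 1)) → Fin 2 × Fin 2
  | ⟨true, y⟩ => incl2 y
  | ⟨false, _⟩ => (0, 1)

theorem isNormal_B11 : IsNormal (tensorC (Bc 1) (Bc 1)) := by
  refine ⟨Bool, m11, ⟨⟨⟨to11, of11, ?_, ?_⟩, ?_, ?_, ?_, ?_, ?_⟩⟩⟩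
  · rintro ⟨a, b⟩
    change Fin 2 at a b
    fin_cases a <;> fin_cases b <;> rfl
  · rintro ⟨_ | _, y⟩
    · change Fin 1 at y
      fin_cases y <;> rfl
    · change Fin 3 at y
      fin_cases y <;> rfl
  all_goals
    rintro ⟨a, b⟩
    change Fin 2 at a b
    fin_cases a <;> fin_cases b <;> rfl

/-- The inclusion `B₂ ↪ B₁ ⊗ B₁` as a crystal morphism. -/
def incl2Hom : CrystalHom (Bc 2) (tensorC (Bc 1) (Bc 1)) where
  toFun := incl2
  map_e x := by
    change Fin 3 at x
    fin_cases x <;> rfl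
  map_f x := by
    change Fin 3 at x
    fin_cases x <;> rfl
  map_wt x := by
    change Fin 3 at x
    fin_cases x <;> rfl
  map_eps x := by
    change Fin 3 at x
    fin_cases x <;> rfl
  map_phi x := by
    change Fin 3 at x
    fin_cases x <;> rfl

/-- The identity morphism. -/
def idHom (A : Sl2Crystal) : CrystalHom A A where
  toFun := id
  map_e x := by simp
  map_f x := by simp
  map_wt _ := rfl
  map_eps _ := rfl
  map_phi _ := rfl

/-- Elements of `B₁ ⊗ B₁` are determined by weight and `ε`. -/
theorem B11_ext (x y : (tensorC (Bc 1) (Bc 1)).carrier)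
    (hw : (tensorC (Bc 1) (Bc 1)).wt x = (tensorC (Bc 1) (Bc 1)).wt y)
    (he : (tensorC (Bc 1) (Bc 1)).eps x = (tensorC (Bc 1) (Bc 1)).eps y) : x = y := by
  obtain ⟨a, b⟩ := x
  obtain ⟨c, d⟩ := y
  change Fin 2 at a b c d
  fin_cases a <;> fin_cases b <;> fin_cases c <;> fin_cases d <;>
    first
    | rfl
    | exact absurd hw (by change ¬ ((_ : ℤ) = _); decide)
    | exact absurd he (by change ¬ ((_ : ℕ) = _); decide)

theorem incl2_ne (z : Fin 3) : incl2 z ≠ ((0 : Fin 2), (1 : Fin 2)) := by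
  revert z
  decide

/-- The category of `sl₂`-crystals cannot be given the structure of a braided monoidal
category: there is no family of crystal isomorphisms `σ_{A,B} : A ⊗ B → B ⊗ A` (for
normal `sl₂`-crystals `A`, `B`) that is natural in both arguments and satisfies the two
hexagon axioms (written pointwise, the monoidal structure on crystals being strict with
strict associators given by re-bracketing of pairs). -/
theorem sl2_crystals_not_braided :
    ¬ ∃ σ : ∀ A B : Sl2Crystal, IsNormal A → IsNormal B →
        CrystalIso (tensorC A B) (tensorC B A),
      -- naturality
      (∀ (A A' B B' : Sl2Crystal) (hA : IsNormal A) (hA' : IsNormal A')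
          (hB : IsNormal B) (hB' : IsNormal B')
          (fh : CrystalHom A A') (gh : CrystalHom B B')
          (x : A.carrier) (y : B.carrier),
          (σ A' B' hA' hB').toEquiv (fh.toFun x, gh.toFun y) =
            (gh.toFun ((σ A B hA hB).toEquiv (x, y)).1,
             fh.toFun ((σ A B hA hB).toEquiv (x, y)).2)) ∧
      -- first hexagon axiom: σ_{A,B⊗C} = (id_B ⊗ σ_{A,C}) ∘ (σ_{A,B} ⊗ id_C)
      (∀ (A B C : Sl2Crystal) (hA : IsNormal A) (hB : IsNormal B) (hC : IsNormal C)
          (hBC : IsNormal (tensorC B C))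
          (a : A.carrier) (b : B.carrier) (c : C.carrier),
          (σ A (tensorC B C) hA hBC).toEquiv (a, (b, c)) =
            ((((σ A B hA hB).toEquiv (a, b)).1,
              ((σ A C hA hC).toEquiv (((σ A B hA hB).toEquiv (a, b)).2, c)).1),
             ((σ A C hA hC).toEquiv (((σ A B hA hB).toEquiv (a, b)).2, c)).2)) ∧
      -- second hexagon axiom: σ_{A⊗B,C} = (σ_{A,C} ⊗ id_B) ∘ (id_A ⊗ σ_{B,C})
      (∀ (A B C : Sl2Crystal) (hA : IsNormal A) (hB : IsNormal B) (hC : IsNormal C)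
          (hAB : IsNormal (tensorC A B))
          (a : A.carrier) (b : B.carrier) (c : C.carrier),
          (σ (tensorC A B) C hAB hC).toEquiv ((a, b), c) =
            (((σ A C hA hC).toEquiv (a, ((σ B C hB hC).toEquiv (b, c)).1)).1,
             (((σ A C hA hC).toEquiv (a, ((σ B C hB hC).toEquiv (b, c)).1)).2,
              ((σ B C hB hC).toEquiv (b, c)).2))) := by
  rintro ⟨σ, hnat, hhex, -⟩
  have h1 := isNormal_Bc 1
  have hid : ∀ x, (σ (Bc 1) (Bc 1) h1 h1).toEquiv x = x := fun x =>
    B11_ext _ _ ((σ (Bc 1) (Bc 1) h1 h1).map_wt x) ((σ (Bc 1) (Bc 1) h1 h1).map_eps x)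
  have hn := hnat (Bc 1) (Bc 1) (Bc 2) (tensorC (Bc 1) (Bc 1)) h1 h1 (isNormal_Bc 2)
    isNormal_B11 (idHom _) incl2Hom (0 : Fin 2) (1 : Fin 3)
  have hh := hhex (Bc 1) (Bc 1) (Bc 1) h1 h1 h1 isNormal_B11 (0 : Fin 2) (1 : Fin 2) (0 : Fin 2)
  have e1 := hid ((0 : Fin 2), (1 : Fin 2))
  have e2 := hid ((1 : Fin 2), (0 : Fin 2))
  rw [e1] at hh
  erw [e2] at hh
  exact incl2_ne _ (congrArg Prod.fst (hn.symm.trans hh))
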